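/- For every Schwartz function f : ℝ → ℂ and every x ∈ ℝ, the map t ↦ P_t f(x) is differentiable on (0,∞), and for all t > 0 one has t·(∂/∂t) P_t f(x) = (φ_{t²} ∗ f)(x). -/

import Mathlib

open MeasureTheory

/-- The subordinated Poisson semigroup of the translation group on `ℝ`:
`P_t f (x) = (1/√π) ∫_0^∞ (e^{−u}/√u) f(x + t²/(4u)) du`. -/
noncomputable def poissonP (f : ℝ → ℂ) (t : ℝ) (x : ℝ) : ℂ :=
  ((Real.sqrt Real.pi)⁻¹ : ℂ) *
    ∫ u in Set.Ioi (0 : ℝ), ((Real.exp (-u) / Real.sqrt u : ℝ) : ℂ) * f (x + t ^ 2 / (4 * u))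
/-- The principal branch value `√(−2πiξ) = √(2π|ξ|)·e^{−i·sgn(ξ)·π/4}`. -/
noncomputable def sqrtSymbol (ξ : ℝ) : ℂ :=
  (Real.sqrt (2 * Real.pi * |ξ|) : ℂ) *
    Complex.exp (-(Real.sign ξ : ℂ) * Complex.I * (Real.pi : ℂ) / 4)

/-- `φ̂(ξ) = −√(−2πiξ)·e^{−√(−2πiξ)}`. -/
noncomputable def phiHat (ξ : ℝ) : ℂ := -sqrtSymbol ξ * Complex.exp (-sqrtSymbol ξ)

/-- `φ`, the inverse Fourier transform of `φ̂`. -/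
noncomputable def phi (x : ℝ) : ℂ :=
  ∫ ξ : ℝ, Complex.exp (2 * (Real.pi : ℂ) * Complex.I * (x : ℂ) * (ξ : ℂ)) * phiHat ξ

/-- The dilation `φ_t(x) = t⁻¹ φ(x/t)`. -/
noncomputable def phiT (t : ℝ) (x : ℝ) : ℂ := ((t : ℂ))⁻¹ * phi (x / t)

section

open Set Filter Topology

theorem exp_neg_mul_rpow_eq_div_sqrt {u : ℝ} (hu : 0 < u) :
    Real.exp (-u) * u ^ ((1 : ℝ) / 2 - 1) = Real.exp (-u) / √u := by
  have h : ((1 : ℝ) / 2 - 1) = -(1 / 2) := by norm_num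
  rw [h, Real.rpow_neg hu.le, ← Real.sqrt_eq_rpow, ← div_eq_mul_inv]

theorem integrableOn_exp_neg_div_sqrt :
    IntegrableOn (fun u : ℝ => Real.exp (-u) / √u) (Ioi 0) :=
  (Real.GammaIntegral_convergent (s := 1 / 2) (by norm_num)).congr_fun
    (fun _ hu => exp_neg_mul_rpow_eq_div_sqrt hu) measurableSet_Ioi

theorem integral_exp_neg_div_sqrt :
    ∫ u in Ioi (0 : ℝ), Real.exp (-u) / √u = √Real.pi := by
  rw [← Real.Gamma_one_half_eq, Real.Gamma_eq_integral (by norm_num)]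
  exact setIntegral_congr_fun measurableSet_Ioi
    fun _ hu => (exp_neg_mul_rpow_eq_div_sqrt hu).symm

/-- The integrand of the subordination integral. -/
noncomputable def subordKernel (a : ℂ) (u : ℝ) : ℂ :=
  ((Real.exp (-u) / √u : ℝ) : ℂ) * Complex.exp (-a / u)

theorem measurable_subordKernel (a : ℂ) : Measurable (subordKernel a) := by
  unfold subordKernel
  fun_prop

theorem norm_subordKernel (a : ℂ) (u : ℝ) :
    ‖subordKernel a u‖ = Real.exp (-u) / √u * Real.exp (-(a.re / u)) := by
  rw [subordKernel, norm_mul, Complex.norm_real, Complex.norm_exp, Complex.div_ofReal_re,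
    Complex.neg_re, neg_div, Real.norm_of_nonneg (by positivity)]

theorem norm_subordKernel_le {a : ℂ} (ha : 0 ≤ a.re) {u : ℝ} (hu : 0 < u) :
    ‖subordKernel a u‖ ≤ Real.exp (-u) / √u := by
  rw [norm_subordKernel]
  refine mul_le_of_le_one_right (by positivity) (Real.exp_le_one_iff.2 ?_)
  have : 0 ≤ a.re / u := by positivity
  linarith

theorem integrableOn_subordKernel {a : ℂ} (ha : 0 ≤ a.re) :
    IntegrableOn (subordKernel a) (Ioi 0) :=
  integrableOn_exp_neg_div_sqrt.mono' (measurable_subordKernel a).aestronglyMeasurable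
    ((ae_restrict_mem measurableSet_Ioi).mono fun _ hu => norm_subordKernel_le ha hu)

theorem continuousOn_integral_subordKernel :
    ContinuousOn (fun a => ∫ u in Ioi (0 : ℝ), subordKernel a u) {a | 0 ≤ a.re} := by
  refine continuousOn_of_dominated
    (fun a _ => (measurable_subordKernel a).aestronglyMeasurable)
    (fun a ha => (ae_restrict_mem measurableSet_Ioi).mono fun _ hu => norm_subordKernel_le ha hu)
    integrableOn_exp_neg_div_sqrt (.of_forall fun u => ?_)
  unfold subordKernel
  fun_prop

theorem hasDerivAt_integral_subordKernel {a : ℂ} (ha : 0 < a.re) :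
    HasDerivAt (fun a => ∫ u in Ioi (0 : ℝ), subordKernel a u)
      (∫ u in Ioi (0 : ℝ), -(u : ℂ)⁻¹ * subordKernel a u) a := by
  have hmem : {b : ℂ | a.re / 2 < b.re} ∈ 𝓝 a :=
    (isOpen_lt continuous_const Complex.continuous_re).mem_nhds (by simpa using ha)
  refine (hasDerivAt_integral_of_dominated_loc_of_deriv_le hmem
    (F' := fun b u => -(u : ℂ)⁻¹ * subordKernel b u)
    (bound := fun u => (2 / a.re) * (Real.exp (-u) / √u))
    (.of_forall fun b => (measurable_subordKernel b).aestronglyMeasurable)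
    (integrableOn_subordKernel ha.le) ?_ ?_ ?_ ?_).2
  · have := measurable_subordKernel a
    exact Measurable.aestronglyMeasurable (by fun_prop)
  · refine (ae_restrict_mem measurableSet_Ioi).mono fun u (hu : 0 < u) b (hb : a.re / 2 < b.re) => ?_
    rw [norm_mul, norm_subordKernel, norm_neg, norm_inv, Complex.norm_real,
      Real.norm_of_nonneg hu.le]
    have hb0 : 0 < b.re := by linarith
    have h1 : Real.exp (-(b.re / u)) ≤ u * (2 / a.re) := by
      have h2 : a.re / 2 / u ≤ Real.exp (b.re / u) := by
        have := Real.add_one_le_exp (b.re / u)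
        have : a.re / 2 / u ≤ b.re / u := by gcongr
        linarith
      rw [Real.exp_neg, inv_le_comm₀ (Real.exp_pos _) (by positivity)]
      have h3 : (u * (2 / a.re))⁻¹ = a.re / 2 / u := by field_simp
      rwa [h3]
    calc u⁻¹ * (Real.exp (-u) / √u * Real.exp (-(b.re / u)))
        ≤ u⁻¹ * (Real.exp (-u) / √u * (u * (2 / a.re))) := by gcongr
      _ = _ := by field_simp
  · exact integrableOn_exp_neg_div_sqrt.const_mul _
  · refine .of_forall fun u b _ => ?_
    unfold subordKernel
    have h : HasDerivAt (fun b : ℂ => -b / u) (-(u : ℂ)⁻¹) b := by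
      simpa [neg_div] using (hasDerivAt_neg b).div_const (u : ℂ)
    exact (h.cexp.const_mul (((Real.exp (-u) / √u : ℝ) : ℂ))).congr_deriv (by ring)

/-- The substitution `u ↦ a / u` in the subordination integral at a positive real point. -/
theorem integral_subordKernel_ofReal {a : ℝ} (ha : 0 < a) :
    ∫ u in Ioi (0 : ℝ), subordKernel a u =
      -(√a : ℂ) * ∫ u in Ioi (0 : ℝ), -(u : ℂ)⁻¹ * subordKernel a u := by
  have himg : (fun u : ℝ => a / u) '' Ioi 0 = Ioi 0 := by
    ext v
    refine ⟨?_, fun hv => ⟨a / v, div_pos ha hv, div_div_cancel₀ ha.ne'⟩⟩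
    rintro ⟨u, hu, rfl⟩
    exact div_pos ha hu
  have key := integral_image_eq_integral_abs_deriv_smul (s := Ioi (0 : ℝ))
    (f := fun u => a / u) (f' := fun u => -a / u ^ 2) measurableSet_Ioi
    (fun u hu => (((hasDerivAt_inv (ne_of_gt hu)).const_mul a).congr_deriv
      (by ring)).hasDerivWithinAt)
    (fun u hu v hv h => by
      have hu : (0 : ℝ) < u := hu
      have hv : (0 : ℝ) < v := hv
      simp only at h
      field_simp at h
      exact h.symm) (subordKernel a)
  rw [himg] at key
  rw [key, ← integral_const_mul]
  refine setIntegral_congr_fun measurableSet_Ioi fun u (hu : 0 < u) => ?_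
  have h1 : |-a / u ^ 2| = a / u ^ 2 := by
    rw [neg_div, abs_neg, abs_of_pos (by positivity)]
  have h2 : a = √a * √a := (Real.mul_self_sqrt ha.le).symm
  have h3 : u = √u * √u := (Real.mul_self_sqrt hu.le).symm
  have h4 : a / u ^ 2 * (Real.exp (-(a / u)) / √(a / u)) * Real.exp (-u)
      = √a * u⁻¹ * (Real.exp (-u) / √u) * Real.exp (-a / u) := by
    have e : -(a / u) = -a / u := by ring
    rw [Real.sqrt_div ha.le, e]
    have := Real.sqrt_pos.2 ha
    have := Real.sqrt_pos.2 hu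
    have h5 : a / u ^ 2 * (1 / (√a / √u)) = √a * u⁻¹ * (1 / √u) := by
      rw [div_mul_div_comm, div_eq_iff (by positivity)]
      field_simp
      nlinarith
    linear_combination h5 * Real.exp (-a / u) * Real.exp (-u)
  simp only [h1, subordKernel]
  have e : -(a : ℂ) / ((a / u : ℝ) : ℂ) = ((-u : ℝ) : ℂ) := by
    have : (a : ℂ) ≠ 0 := by exact_mod_cast ha.ne'
    push_cast
    field_simp
  rw [e, Complex.real_smul]
  have h6 := congrArg (fun r : ℝ => (r : ℂ)) h4
  push_cast at h6 ⊢
  linear_combination h6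

/-- The subordination formula on the closed right half-plane. -/
theorem integral_subordKernel {a : ℂ} (ha : 0 ≤ a.re) :
    ∫ u in Ioi (0 : ℝ), subordKernel a u =
      √Real.pi * Complex.exp (-(2 * a ^ (2⁻¹ : ℂ))) := by
  set K : ℂ → ℂ := fun a => ∫ u in Ioi (0 : ℝ), subordKernel a u with hK
  set G : ℂ → ℂ := fun a => K a * Complex.exp (2 * a ^ (2⁻¹ : ℂ)) with hG
  have hopen : IsOpen {a : ℂ | 0 < a.re} := isOpen_lt continuous_const Complex.continuous_re
  have hconv : IsPreconnected {a : ℂ | 0 < a.re} := (convex_halfSpace_re_gt 0).isPreconnected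
  have hderiv : ∀ a : ℂ, 0 < a.re → HasDerivAt G
      ((∫ u in Ioi (0 : ℝ), -(u : ℂ)⁻¹ * subordKernel a u) * Complex.exp (2 * a ^ (2⁻¹ : ℂ)) +
        K a * (Complex.exp (2 * a ^ (2⁻¹ : ℂ)) * (2 * (2⁻¹ * a ^ (2⁻¹ - 1 : ℂ))))) a := by
    intro a ha
    have := ((hasDerivAt_id a).cpow_const (c := 2⁻¹) (Or.inl ha)).const_mul (2 : ℂ)
    simp only [id, mul_one] at this
    exact (hasDerivAt_integral_subordKernel ha).mul this.cexp
  have hdiff : DifferentiableOn ℂ G {a : ℂ | 0 < a.re} := fun a ha =>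
    (hderiv a ha).differentiableAt.differentiableWithinAt
  have hreal : ∀ r : ℝ, 0 < r → deriv G r = 0 := by
    intro r hr
    rw [(hderiv r (by simpa using hr)).deriv]
    simp only [hK]
    rw [integral_subordKernel_ofReal hr]
    have h1 : (r : ℂ) ^ (2⁻¹ - 1 : ℂ) = ((√r)⁻¹ : ℝ) := by
      rw [Real.sqrt_eq_rpow, ← Real.rpow_neg hr.le, Complex.ofReal_cpow hr.le]
      norm_num
    have h2 : (√r : ℂ) ≠ 0 := by exact_mod_cast (Real.sqrt_pos.2 hr).ne'
    rw [h1]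
    push_cast
    field_simp
    ring
  have hzero : EqOn (deriv G) 0 {a : ℂ | 0 < a.re} := by
    refine AnalyticOnNhd.eqOn_of_preconnected_of_frequently_eq (𝕜 := ℂ)
      (hdiff.analyticOnNhd hopen).deriv (fun _ _ => analyticAt_const) hconv (z₀ := (1 : ℝ)) (by simp) ?_
    have ht : Tendsto (fun r : ℝ => (r : ℂ)) (𝓝[≠] 1) (𝓝[≠] ((1 : ℝ) : ℂ)) :=
      Complex.continuous_ofReal.continuousAt.continuousWithinAt.tendsto_nhdsWithin
        fun r hr => by simpa using hr
    refine ht.frequently (Eventually.frequently ?_)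
    filter_upwards [nhdsWithin_le_nhds (Ioi_mem_nhds (zero_lt_one' ℝ))] with r hr
    simpa using hreal r hr
  have hcont : ContinuousOn G {a : ℂ | 0 ≤ a.re} := by
    refine continuousOn_integral_subordKernel.mul fun b hb => ?_
    have := Complex.continuousAt_cpow_const_of_re_pos (z := b) (w := 2⁻¹) (Or.inl hb) (by norm_num)
    exact (this.const_mul 2).cexp.continuousWithinAt
  have hconst : EqOn G (fun _ => G 1) {a : ℂ | 0 ≤ a.re} := by
    refine EqOn.of_subset_closure (s := {a : ℂ | 0 < a.re}) (fun b hb => ?_) hcont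
      continuousOn_const (fun b (hb : 0 < b.re) => hb.le) (Complex.closure_setOfPred_lt_re 0).ge
    exact hopen.is_const_of_deriv_eq_zero hconv hdiff hzero hb (by simp)
  have h0 : G 0 = √Real.pi := by
    simp only [hG, hK, subordKernel]
    rw [Complex.zero_cpow (by norm_num)]
    simp only [neg_zero, zero_div, Complex.exp_zero, mul_one, mul_zero]
    rw [integral_complex_ofReal, integral_exp_neg_div_sqrt]
  have h1 : G a = √Real.pi := by
    rw [← h0, hconst ha, hconst (show (0 : ℂ) ∈ _ by simp)]
  rw [Complex.exp_neg, eq_mul_inv_iff_mul_eq₀ (Complex.exp_ne_zero _)]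
  exact h1

theorem measurable_sqrtSymbol : Measurable sqrtSymbol := by
  have : Measurable Real.sign := by
    unfold Real.sign
    exact Measurable.ite measurableSet_Iio measurable_const
      (Measurable.ite measurableSet_Ioi measurable_const measurable_const)
  unfold sqrtSymbol
  fun_prop

theorem norm_sqrtSymbol (ξ : ℝ) : ‖sqrtSymbol ξ‖ = √(2 * Real.pi * |ξ|) := by
  have h : -(Real.sign ξ : ℂ) * Complex.I * Real.pi / 4
      = ((-(Real.sign ξ * Real.pi / 4) : ℝ) : ℂ) * Complex.I := by
    push_cast
    ring
  rw [sqrtSymbol, h, norm_mul, Complex.norm_exp_ofReal_mul_I, Complex.norm_real, mul_one,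
    Real.norm_of_nonneg (Real.sqrt_nonneg _)]

theorem sqrtSymbol_re (ξ : ℝ) : (sqrtSymbol ξ).re = √(Real.pi * |ξ|) := by
  have h : -(Real.sign ξ : ℂ) * Complex.I * Real.pi / 4
      = ((-(Real.sign ξ * (Real.pi / 4)) : ℝ) : ℂ) * Complex.I := by
    push_cast
    ring
  rw [sqrtSymbol, h, Complex.re_ofReal_mul, Complex.exp_ofReal_mul_I_re, Real.cos_neg]
  rcases lt_trichotomy ξ 0 with hξ | rfl | hξ
  · rw [Real.sign_of_neg hξ, neg_one_mul, Real.cos_neg, Real.cos_pi_div_four, mul_assoc,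
      Real.sqrt_mul zero_le_two]
    linear_combination √(Real.pi * |ξ|) / 2 * Real.mul_self_sqrt zero_le_two
  · simp
  · rw [Real.sign_of_pos hξ, one_mul, Real.cos_pi_div_four, mul_assoc,
      Real.sqrt_mul zero_le_two]
    linear_combination √(Real.pi * |ξ|) / 2 * Real.mul_self_sqrt zero_le_two

theorem sqrtSymbol_re_nonneg (ξ : ℝ) : 0 ≤ (sqrtSymbol ξ).re :=
  sqrtSymbol_re ξ ▸ Real.sqrt_nonneg _

theorem sqrtSymbol_sq (ξ : ℝ) : sqrtSymbol ξ ^ 2 = -(2 * Real.pi * Complex.I * ξ) := by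
  have hs : ((√(2 * Real.pi * |ξ|) : ℝ) : ℂ) ^ 2 = 2 * Real.pi * (|ξ| : ℝ) := by
    rw [← Complex.ofReal_pow, Real.sq_sqrt (by positivity)]
    push_cast
    rfl
  rw [sqrtSymbol, mul_pow, hs, ← Complex.exp_nat_mul]
  rcases lt_trichotomy ξ 0 with hξ | rfl | hξ
  · have e : ((2 : ℕ) : ℂ) * (-((-1 : ℝ) : ℂ) * Complex.I * Real.pi / 4)
        = Real.pi / 2 * Complex.I := by
      push_cast
      ring
    rw [Real.sign_of_neg hξ, abs_of_neg hξ, e, Complex.exp_pi_div_two_mul_I]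
    push_cast
    ring
  · simp
  · have e : ((2 : ℕ) : ℂ) * (-((1 : ℝ) : ℂ) * Complex.I * Real.pi / 4)
        = -(Real.pi / 2 * Complex.I) := by
      push_cast
      ring
    rw [Real.sign_of_pos hξ, abs_of_pos hξ, e, Complex.exp_neg, Complex.exp_pi_div_two_mul_I,
      Complex.inv_I]
    ring

theorem sqrtSymbol_sq_mul {t : ℝ} (ht : 0 < t) (ξ : ℝ) :
    sqrtSymbol (t ^ 2 * ξ) = t * sqrtSymbol ξ := by
  have hsign : Real.sign (t ^ 2 * ξ) = Real.sign ξ := by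
    have ht2 : 0 < t ^ 2 := by positivity
    rcases lt_trichotomy ξ 0 with hξ | rfl | hξ
    · rw [Real.sign_of_neg hξ, Real.sign_of_neg (mul_neg_of_pos_of_neg ht2 hξ)]
    · simp
    · rw [Real.sign_of_pos hξ, Real.sign_of_pos (mul_pos ht2 hξ)]
  have hs : √(2 * Real.pi * |t ^ 2 * ξ|) = t * √(2 * Real.pi * |ξ|) := by
    rw [abs_mul, abs_of_pos (by positivity : 0 < t ^ 2),
      show 2 * Real.pi * (t ^ 2 * |ξ|) = t ^ 2 * (2 * Real.pi * |ξ|) by ring,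
      Real.sqrt_mul (by positivity), Real.sqrt_sq ht.le]
  rw [sqrtSymbol, sqrtSymbol, hsign, hs]
  push_cast
  ring

theorem norm_exp_neg_mul_sqrtSymbol_le {t : ℝ} (ht : 0 ≤ t) (ξ : ℝ) :
    ‖Complex.exp (-(t * sqrtSymbol ξ))‖ ≤ 1 := by
  rw [Complex.norm_exp, Real.exp_le_one_iff, Complex.neg_re, Complex.re_ofReal_mul]
  have := mul_nonneg ht (sqrtSymbol_re_nonneg ξ)
  linarith

/-- The Fourier multiplier of the subordinated Poisson semigroup. -/
theorem integral_mul_exp_eq_exp_neg_mul_sqrtSymbol {t : ℝ} (ht : 0 < t) (ξ : ℝ) :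
    ∫ u in Ioi (0 : ℝ), ((Real.exp (-u) / √u : ℝ) : ℂ) *
      Complex.exp (2 * Real.pi * Complex.I * (t ^ 2 / (4 * u) : ℝ) * ξ) =
      √Real.pi * Complex.exp (-(t * sqrtSymbol ξ)) := by
  set a : ℂ := (t * sqrtSymbol ξ / 2) ^ 2 with ha
  have ha' : a = ((-(Real.pi * ξ * t ^ 2 / 2) : ℝ) : ℂ) * Complex.I := by
    rw [ha, div_pow, mul_pow, sqrtSymbol_sq]
    push_cast
    ring
  have hre : a.re = 0 := by
    rw [ha', Complex.re_ofReal_mul, Complex.I_re, mul_zero]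
  have hroot : a ^ (2⁻¹ : ℂ) = t * sqrtSymbol ξ / 2 := by
    rcases eq_or_ne ξ 0 with rfl | hξ
    · have : sqrtSymbol 0 = 0 := by simp [sqrtSymbol]
      rw [ha, this]
      simp
    · refine Complex.sq_cpow_two_inv ?_
      rw [mul_div_right_comm, show (t : ℂ) / 2 = ((t / 2 : ℝ) : ℂ) by push_cast; rfl,
        Complex.re_ofReal_mul, sqrtSymbol_re]
      have := abs_pos.2 hξ
      positivity
  have key := integral_subordKernel hre.ge
  rw [hroot, mul_div_cancel₀ _ two_ne_zero] at key
  rw [← key]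
  refine setIntegral_congr_fun measurableSet_Ioi fun u (hu : 0 < u) => ?_
  simp only [subordKernel]
  congr 2
  have : (u : ℂ) ≠ 0 := by exact_mod_cast hu.ne'
  rw [ha']
  push_cast
  field_simp
  ring

theorem norm_exp_two_pi_I_mul (x ξ : ℝ) :
    ‖Complex.exp (2 * Real.pi * Complex.I * x * ξ)‖ = 1 := by
  rw [show 2 * Real.pi * Complex.I * x * ξ = ((2 * Real.pi * x * ξ : ℝ) : ℂ) * Complex.I by
    push_cast; ring, Complex.norm_exp_ofReal_mul_I]

theorem SchwartzMap.eq_integral_exp_mul_fourier (f : SchwartzMap ℝ ℂ) (x : ℝ) :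
    f x = ∫ ξ : ℝ, Complex.exp (2 * Real.pi * Complex.I * x * ξ) *
      FourierTransform.fourier f ξ := by
  conv_lhs => rw [← FourierTransform.fourierInv_fourier_eq (F := SchwartzMap ℝ ℂ) f]
  rw [SchwartzMap.fourierInv_coe, Real.fourierInv_eq']
  refine integral_congr_ae (.of_forall fun ξ => ?_)
  simp only [smul_eq_mul, RCLike.inner_apply, conj_trivial]
  congr 2
  push_cast
  ring

theorem SchwartzMap.fourier_eq_integral_exp_mul (f : SchwartzMap ℝ ℂ) (ξ : ℝ) :
    FourierTransform.fourier f ξ =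
      ∫ y : ℝ, Complex.exp (-(2 * Real.pi * Complex.I * y * ξ)) * f y := by
  rw [SchwartzMap.fourier_coe, Real.fourier_real_eq_integral_exp_smul]
  refine integral_congr_ae (.of_forall fun y => ?_)
  simp only [smul_eq_mul]
  congr 2
  push_cast
  ring

/-- The Fourier representation of the subordinated Poisson semigroup. -/
theorem poissonP_eq_integral_fourier (f : SchwartzMap ℝ ℂ) (x : ℝ) {t : ℝ} (ht : 0 < t) :
    poissonP f t x = ∫ ξ : ℝ, Complex.exp (-(t * sqrtSymbol ξ)) *
      (Complex.exp (2 * Real.pi * Complex.I * x * ξ) * FourierTransform.fourier f ξ) := by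
  set g : ℝ → ℂ := ⇑(FourierTransform.fourier f) with hg
  have hgi : Integrable g := (FourierTransform.fourier f).integrable
  have hwi : Integrable (fun u : ℝ => ((Real.exp (-u) / √u : ℝ) : ℂ))
      (volume.restrict (Ioi 0)) := integrableOn_exp_neg_div_sqrt.ofReal
  have hswap := integral_integral_swap (μ := volume.restrict (Ioi (0 : ℝ))) (ν := volume)
    (f := fun (u ξ : ℝ) => Complex.exp (2 * Real.pi * Complex.I * (x + t ^ 2 / (4 * u) : ℝ) * ξ) *
      (((Real.exp (-u) / √u : ℝ) : ℂ) * g ξ))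
    ((hwi.mul_prod hgi).bdd_mul (c := 1)
      (Measurable.aestronglyMeasurable (by fun_prop))
      (.of_forall fun p => (norm_exp_two_pi_I_mul _ _).le))
  have hpi : (√Real.pi : ℂ) ≠ 0 := by exact_mod_cast (Real.sqrt_pos.2 Real.pi_pos).ne'
  calc poissonP f t x = (√Real.pi : ℂ)⁻¹ * ∫ u in Ioi (0 : ℝ), ∫ ξ : ℝ,
        Complex.exp (2 * Real.pi * Complex.I * (x + t ^ 2 / (4 * u) : ℝ) * ξ) *
          (((Real.exp (-u) / √u : ℝ) : ℂ) * g ξ) := by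
        rw [poissonP]
        congr 1
        refine integral_congr_ae (.of_forall fun u => ?_)
        simp only
        rw [f.eq_integral_exp_mul_fourier, ← integral_const_mul]
        refine integral_congr_ae (.of_forall fun ξ => ?_)
        simp only [hg]
        ring
    _ = _ := by
        rw [hswap, ← integral_const_mul]
        refine integral_congr_ae (.of_forall fun ξ => ?_)
        simp only
        have h : ∀ u : ℝ, Complex.exp (2 * Real.pi * Complex.I * (x + t ^ 2 / (4 * u) : ℝ) * ξ) *
            (((Real.exp (-u) / √u : ℝ) : ℂ) * g ξ) =
            (Complex.exp (2 * Real.pi * Complex.I * x * ξ) * g ξ) *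
            (((Real.exp (-u) / √u : ℝ) : ℂ) *
              Complex.exp (2 * Real.pi * Complex.I * (t ^ 2 / (4 * u) : ℝ) * ξ)) := by
          intro u
          rw [Complex.ofReal_add, mul_add, add_mul, Complex.exp_add]
          ring
        simp only [h]
        rw [integral_const_mul, integral_mul_exp_eq_exp_neg_mul_sqrtSymbol ht]
        field_simp

theorem norm_sqrtSymbol_le (ξ : ℝ) : ‖sqrtSymbol ξ‖ ≤ 2 * Real.pi * ‖ξ‖ + 1 := by
  rw [norm_sqrtSymbol, Real.norm_eq_abs]
  have h : (0 : ℝ) ≤ 2 * Real.pi * |ξ| := by positivity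
  exact Real.sqrt_le_iff.2 ⟨by positivity, by nlinarith⟩

theorem hasDerivAt_poissonP (f : SchwartzMap ℝ ℂ) (x : ℝ) {t : ℝ} (ht : 0 < t) :
    HasDerivAt (fun s => poissonP f s x)
      (∫ ξ : ℝ, -sqrtSymbol ξ * Complex.exp (-(t * sqrtSymbol ξ)) *
        (Complex.exp (2 * Real.pi * Complex.I * x * ξ) * FourierTransform.fourier f ξ)) t := by
  set g : ℝ → ℂ := ⇑(FourierTransform.fourier f) with hg
  have hgi : Integrable g := (FourierTransform.fourier f).integrable
  have hgm : Measurable g := (FourierTransform.fourier f).continuous.measurable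
  have hσ := measurable_sqrtSymbol
  have hev : (fun s => poissonP f s x) =ᶠ[𝓝 t] fun s => ∫ ξ : ℝ,
      Complex.exp (-(s * sqrtSymbol ξ)) * (Complex.exp (2 * Real.pi * Complex.I * x * ξ) * g ξ) := by
    filter_upwards [Ioi_mem_nhds ht] with s hs
    exact poissonP_eq_integral_fourier f x hs
  refine HasDerivAt.congr_of_eventuallyEq ?_ hev
  refine (hasDerivAt_integral_of_dominated_loc_of_deriv_le (Ioi_mem_nhds ht)
    (bound := fun ξ => (2 * Real.pi * ‖ξ‖ + 1) * ‖g ξ‖)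
    (F' := fun s ξ => -sqrtSymbol ξ * Complex.exp (-((s : ℝ) * sqrtSymbol ξ)) *
      (Complex.exp (2 * Real.pi * Complex.I * x * ξ) * g ξ))
    (.of_forall fun s => Measurable.aestronglyMeasurable (by fun_prop)) ?_
    (Measurable.aestronglyMeasurable (by fun_prop)) ?_ ?_ ?_).2
  · refine hgi.norm.mono' (Measurable.aestronglyMeasurable (by fun_prop)) (.of_forall fun ξ => ?_)
    rw [norm_mul, norm_mul, norm_exp_two_pi_I_mul, one_mul]
    exact mul_le_of_le_one_left (norm_nonneg _) (norm_exp_neg_mul_sqrtSymbol_le ht.le ξ)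
  · refine .of_forall fun ξ s (hs : 0 < s) => ?_
    rw [norm_mul, norm_mul, norm_mul, norm_exp_two_pi_I_mul, one_mul, norm_neg]
    gcongr
    exact (mul_le_of_le_one_right (norm_nonneg _) (norm_exp_neg_mul_sqrtSymbol_le hs.le ξ)).trans
      (norm_sqrtSymbol_le ξ)
  · have h1 := ((FourierTransform.fourier f).integrable_pow_mul volume 1).const_mul (2 * Real.pi)
    refine (h1.add hgi.norm).congr (.of_forall fun ξ => ?_)
    simp only [Pi.add_apply, pow_one, hg]
    ring
  · refine .of_forall fun ξ s _ => ?_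
    have h : HasDerivAt (fun s : ℝ => -((s : ℂ) * sqrtSymbol ξ)) (-sqrtSymbol ξ) s := by
      simpa using ((Complex.ofRealCLM.hasDerivAt (x := s)).mul_const (sqrtSymbol ξ)).fun_neg
    exact (h.cexp.mul_const _).congr_deriv (by ring)

theorem integrable_phiHat : Integrable phiHat := by
  have hσ := measurable_sqrtSymbol
  refine (integrable_inv_one_add_sq.const_mul (√2 * 121)).mono'
    (Measurable.aestronglyMeasurable (by unfold phiHat; fun_prop)) (.of_forall fun ξ => ?_)
  set s := √(Real.pi * |ξ|) with hs
  have hs0 : 0 ≤ s := Real.sqrt_nonneg _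
  have hs2 : s ^ 2 = Real.pi * |ξ| := Real.sq_sqrt (by positivity)
  have hξ : ξ ^ 2 ≤ s ^ 4 := by
    have h1 : s ^ 4 = Real.pi ^ 2 * ξ ^ 2 := by
      rw [← sq_abs ξ, ← mul_pow, ← hs2, ← pow_mul]
    rw [h1]
    exact le_mul_of_one_le_left (sq_nonneg _) (one_le_pow₀ (by linarith [Real.pi_gt_three]))
  have hexp : s * (1 + ξ ^ 2) ≤ 121 * Real.exp s := by
    have h1 := Real.add_one_le_exp s
    have h2 := Real.pow_div_factorial_le_exp s hs0 5
    have h3 : ((Nat.factorial 5 : ℕ) : ℝ) = 120 := by norm_num [Nat.factorial]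
    rw [h3, div_le_iff₀ (by norm_num)] at h2
    have h4 : s * ξ ^ 2 ≤ s * s ^ 4 := by gcongr
    linarith [show s * s ^ 4 = s ^ 5 by ring]
  rw [phiHat, norm_mul, norm_neg, norm_sqrtSymbol, Complex.norm_exp, Complex.neg_re, sqrtSymbol_re,
    mul_assoc, Real.sqrt_mul zero_le_two, ← hs, mul_assoc, mul_assoc]
  refine mul_le_mul_of_nonneg_left ?_ (Real.sqrt_nonneg _)
  rw [Real.exp_neg, ← div_eq_mul_inv, ← div_eq_mul_inv,
    div_le_div_iff₀ (Real.exp_pos _) (by positivity)]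
  exact hexp

theorem phiT_sq_eq_integral {t : ℝ} (ht : 0 < t) (z : ℝ) :
    phiT (t ^ 2) z =
      ∫ ξ : ℝ, Complex.exp (2 * Real.pi * Complex.I * z * ξ) * phiHat (t ^ 2 * ξ) := by
  have ht2 : 0 < t ^ 2 := by positivity
  have h := Measure.integral_comp_mul_left
    (fun η : ℝ => Complex.exp (2 * Real.pi * Complex.I * (z / t ^ 2 : ℝ) * η) * phiHat η) (t ^ 2)
  rw [phiT, phi, ← Complex.ofReal_inv, ← Complex.real_smul, ← abs_of_pos (inv_pos.2 ht2), ← h]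
  refine integral_congr_ae (.of_forall fun ξ => ?_)
  have : (t : ℂ) ≠ 0 := by exact_mod_cast ht.ne'
  simp only
  congr 2
  push_cast
  field_simp

theorem integral_phiT_sq_mul (f : SchwartzMap ℝ ℂ) (x : ℝ) {t : ℝ} (ht : 0 < t) :
    ∫ y : ℝ, phiT (t ^ 2) (x - y) * f y = ∫ ξ : ℝ, phiHat (t ^ 2 * ξ) *
      (Complex.exp (2 * Real.pi * Complex.I * x * ξ) * FourierTransform.fourier f ξ) := by
  have hi : Integrable fun ξ : ℝ => phiHat (t ^ 2 * ξ) :=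
    integrable_phiHat.comp_mul_left' (by positivity)
  have hswap := integral_integral_swap (μ := volume) (ν := volume)
    (f := fun (y ξ : ℝ) => Complex.exp (2 * Real.pi * Complex.I * (x - y : ℝ) * ξ) *
      (f y * phiHat (t ^ 2 * ξ)))
    ((f.integrable.mul_prod hi).bdd_mul (c := 1)
      (Measurable.aestronglyMeasurable (by fun_prop))
      (.of_forall fun p => (norm_exp_two_pi_I_mul _ _).le))
  calc ∫ y : ℝ, phiT (t ^ 2) (x - y) * f y = ∫ y : ℝ, ∫ ξ : ℝ,
        Complex.exp (2 * Real.pi * Complex.I * (x - y : ℝ) * ξ) *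
          (f y * phiHat (t ^ 2 * ξ)) := by
        refine integral_congr_ae (.of_forall fun y => ?_)
        simp only
        rw [phiT_sq_eq_integral ht, ← integral_mul_const]
        refine integral_congr_ae (.of_forall fun ξ => ?_)
        simp only
        ring
    _ = _ := by
        rw [hswap]
        refine integral_congr_ae (.of_forall fun ξ => ?_)
        simp only
        rw [f.fourier_eq_integral_exp_mul, ← integral_const_mul, ← integral_const_mul]
        refine integral_congr_ae (.of_forall fun y => ?_)
        simp only
        rw [Complex.ofReal_sub, mul_sub, sub_mul, sub_eq_add_neg, Complex.exp_add]
        ring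

end

/-- For every Schwartz function `f` and every `x ∈ ℝ`, the map `t ↦ P_t f(x)` is
differentiable on `(0,∞)` and `t·∂_t P_t f(x) = (φ_{t²} ∗ f)(x)` for all `t > 0`. -/
theorem deriv_subordinated_poisson_eq_conv (f : SchwartzMap ℝ ℂ) (x : ℝ) :
    ∀ t : ℝ, 0 < t →
      DifferentiableAt ℝ (fun s => poissonP (⇑f) s x) t ∧
        (t : ℂ) * deriv (fun s => poissonP (⇑f) s x) t =
          ∫ y : ℝ, phiT (t ^ 2) (x - y) * f y := by
  intro t ht
  have hd := hasDerivAt_poissonP f x ht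
  refine ⟨hd.differentiableAt, ?_⟩
  rw [hd.deriv, integral_phiT_sq_mul f x ht, ← integral_const_mul]
  refine integral_congr_ae (.of_forall fun ξ => ?_)
  simp only [phiHat, sqrtSymbol_sq_mul ht]
  ring
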